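/- Let V = ℂ^m with G = O(V), and let Λ ∈ (V^{⊗m})^{G,det} be the antisymmetrization of e_1⊗…⊗e_m. Then every SO(V)-invariant element of V^{⊗r} is a sum ξ_0 + ξ_1 where ξ_0 ∈ (V^{⊗r})^{O(V)} and ξ_1 lies in the span of {σ·(Λ ⊗ Č^{⊗(r−m)/2}) : σ ∈ S_r} (with ξ_1 = 0 unless r ≥ m and r ≡ m mod 2). -/

import Mathlib

open scoped BigOperators

namespace EnhBrauer

/-- Coordinates of a tensor in `V^{⊗r}` for `V = ℂ^m`, w.r.t. the orthonormal basis. -/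
abbrev Tens (m r : ℕ) := (Fin r → Fin m) → ℂ

/-- `A` is an orthogonal matrix: `A.transpose * A = 1`. -/
def IsOrth {m : ℕ} (A : Matrix (Fin m) (Fin m) ℂ) : Prop := A.transpose * A = 1

/-- The diagonal action of a matrix on `V^{⊗r}` in coordinates. -/
noncomputable def act {m r : ℕ} (A : Matrix (Fin m) (Fin m) ℂ) (x : Tens m r) : Tens m r :=
  fun f => ∑ f' : Fin r → Fin m, (∏ i, A (f i) (f' i)) * x f'

/-- Action of a permutation on `V^{⊗r}` by permuting the tensor factors. -/
def permAct {m r : ℕ} (σ : Equiv.Perm (Fin r)) (x : Tens m r) : Tens m r :=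
  fun f => x (f ∘ σ)

/-- The symmetric bilinear form on `V^{⊗r}` extending `(·,·)` multiplicatively. -/
noncomputable def form {m r : ℕ} (x y : Tens m r) : ℂ :=
  ∑ f : Fin r → Fin m, x f * y f

/-- `Č = ∑ i, e i ⊗ e i ∈ V ⊗ V`. -/
def cC (m : ℕ) : Tens m 2 := fun f => if f 0 = f 1 then 1 else 0

/-- `Ĉ : V ⊗ V → ℂ`, `v ⊗ w ↦ (v, w)`. -/
noncomputable def hatC {m : ℕ} (x : Tens m 2) : ℂ := ∑ i : Fin m, x (fun _ => i)

/-- `Č^{⊗d} ∈ V^{⊗2d}`. -/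
def cCpow (m d : ℕ) : Tens m (2 * d) :=
  fun f => ∏ i : Fin d,
    (if f ⟨2 * i, by have := i.isLt; omega⟩ = f ⟨2 * i + 1, by have := i.isLt; omega⟩
      then (1 : ℂ) else 0)

/-- Tensor product (concatenation) of tensors. -/
def tmul {m r s : ℕ} (x : Tens m r) (y : Tens m s) : Tens m (r + s) :=
  fun f => x (fun i => f (Fin.castAdd s i)) * y (fun j => f (Fin.natAdd r j))

/-- `Λ = (m!)⁻¹ ∑_{σ ∈ S_m} ε(σ) σ · (e 1 ⊗ ⋯ ⊗ e m)`. -/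
noncomputable def Lam (m : ℕ) : Tens m m :=
  fun f => ((m.factorial : ℂ))⁻¹ *
    ∑ σ : Equiv.Perm (Fin m), ((Equiv.Perm.sign σ : ℤ) : ℂ) * (if ∀ i, f i = σ i then 1 else 0)

/-- The total antisymmetrizer `Σ_r = ∑_{π ∈ S_r} ε(π) π` on `V^{⊗r}`. -/
noncomputable def SigmaA (m r : ℕ) : Tens m r → Tens m r :=
  fun x f => ∑ σ : Equiv.Perm (Fin r), ((Equiv.Perm.sign σ : ℤ) : ℂ) * x (f ∘ σ)

/-- `x ∈ V^{⊗r}` is harmonic: contracting any two distinct tensor factors with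
the form gives `0`. -/
def Harmonic {m r : ℕ} (x : Tens m r) : Prop :=
  ∀ a b : Fin r, a ≠ b → ∀ f : Fin r → Fin m,
    ∑ j : Fin m, x (Function.update (Function.update f a j) b j) = 0

lemma act_add {m r : ℕ} (A : Matrix (Fin m) (Fin m) ℂ) (x y : Tens m r) :
    act A (x + y) = act A x + act A y := by
  funext f
  simp [act, mul_add, Finset.sum_add_distrib]

lemma act_zero {m r : ℕ} (A : Matrix (Fin m) (Fin m) ℂ) :
    act A (0 : Tens m r) = 0 := by
  funext f; simp [act]

lemma act_smul {m r : ℕ} (A : Matrix (Fin m) (Fin m) ℂ) (c : ℂ) (x : Tens m r) :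
    act A (c • x) = c • act A x := by
  funext f
  simp only [act, Pi.smul_apply, smul_eq_mul, Finset.mul_sum]
  exact Finset.sum_congr rfl fun f' _ => by ring

/-- The submodule of tensors in `V^{⊗r}` invariant under all matrices satisfying `P`. -/
noncomputable def invSub (m r : ℕ) (P : Matrix (Fin m) (Fin m) ℂ → Prop) :
    Submodule ℂ (Tens m r) where
  carrier := {x | ∀ A, P A → act A x = x}
  add_mem' := by intro x y hx hy A hA; rw [act_add, hx A hA, hy A hA]
  zero_mem' := by intro A hA; exact act_zero A
  smul_mem' := by intro c x hx A hA; rw [act_smul, hx A hA]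

/-- The submodule of linear maps `V^{⊗s} → V^{⊗t}` equivariant for all matrices
satisfying `P`. -/
noncomputable def homSub (m s t : ℕ) (P : Matrix (Fin m) (Fin m) ℂ → Prop) :
    Submodule ℂ (Tens m s →ₗ[ℂ] Tens m t) where
  carrier := {T | ∀ A, P A → ∀ x, T (act A x) = act A (T x)}
  add_mem' := by
    intro T S hT hS A hA x
    simp [hT A hA x, hS A hA x, act_add]
  zero_mem' := by
    intro A hA x
    simp [act_zero]
  smul_mem' := by
    intro c T hT A hA x
    simp [hT A hA x, act_smul]

section helpers
open Function

abbrev TI (m : ℕ) (ι : Type) := (ι → Fin m) → ℂ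

set_option linter.unusedSectionVars false

variable {m : ℕ} {ι κ : Type} [Fintype ι] [DecidableEq ι] [Fintype κ] [DecidableEq κ]

noncomputable def actI (A : Matrix (Fin m) (Fin m) ℂ) (x : TI m ι) : TI m ι :=
  fun f => ∑ f' : ι → Fin m, (∏ i, A (f i) (f' i)) * x f'

noncomputable def DD (a b : Fin m) (x : TI m ι) : TI m ι :=
  fun f => ∑ i, if f i = a then x (update f i b) else 0

lemma upd_swap (f : ι → Fin m) {i j : ι} (h : i ≠ j) :
    update (update f i (f j)) j (f i) = f ∘ Equiv.swap i j := by
  funext k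
  simp only [update_apply, comp_apply, Equiv.swap_apply_def]
  split_ifs <;> simp_all

lemma DD1 (x : TI m ι) (f : ι → Fin m) :
    ∑ a, ∑ b, DD a b (DD b a x) f =
      (Fintype.card ι : ℂ) * m * x f
        + ∑ i, ∑ j, if i = j then 0 else x (f ∘ Equiv.swap i j) := by
  have h1 : ∑ a, ∑ b, DD a b (DD b a x) f = ∑ i, ∑ j, ∑ a, ∑ b,
      if f i = a then (if update f i b j = b then x (update (update f i b) j a) else 0) else 0 := by
    simp only [DD]
    have : ∀ a b : Fin m, (∑ i, if f i = a then
        ∑ j, (if update f i b j = b then x (update (update f i b) j a) else 0) else 0) =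
        ∑ i, ∑ j, if f i = a then
        (if update f i b j = b then x (update (update f i b) j a) else 0) else 0 := by
      intro a b
      refine Finset.sum_congr rfl fun i _ => ?_
      split_ifs <;> simp
    simp only [this]
    rw [Finset.sum_congr rfl fun a _ => Finset.sum_comm, Finset.sum_comm]
    refine Finset.sum_congr rfl fun i _ => ?_
    rw [Finset.sum_congr rfl fun a _ => Finset.sum_comm, Finset.sum_comm]
  have h2 : ∀ i j, (∑ a, ∑ b,
      if f i = a then (if update f i b j = b then x (update (update f i b) j a) else 0) else 0)
      = (if i = j then (m : ℂ) * x f else 0) +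
        (if i = j then 0 else x (f ∘ Equiv.swap i j)) := by
    intro i j
    rw [Finset.sum_comm]
    simp only [Finset.sum_ite_eq, Finset.mem_univ, if_true]
    by_cases h : i = j
    · subst h; simp
    · simp only [h, if_false, update_of_ne (Ne.symm h), Finset.sum_ite_eq, Finset.mem_univ,
        if_true, zero_add, upd_swap f h]
  rw [h1]
  simp only [h2, Finset.sum_add_distrib]
  simp [mul_assoc]

lemma DD2 (x : TI m ι) (f : ι → Fin m) :
    ∑ a, ∑ b, DD a b (DD a b x) f =
      (Fintype.card ι : ℂ) * x f
        + ∑ i, ∑ j, if i = j then 0 else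
          if f i = f j then ∑ b, x (update (update f i b) j b) else 0 := by
  have h1 : ∑ a, ∑ b, DD a b (DD a b x) f = ∑ i, ∑ j, ∑ a, ∑ b,
      if f i = a then (if update f i b j = a then x (update (update f i b) j b) else 0) else 0 := by
    simp only [DD]
    have : ∀ a b : Fin m, (∑ i, if f i = a then
        ∑ j, (if update f i b j = a then x (update (update f i b) j b) else 0) else 0) =
        ∑ i, ∑ j, if f i = a then
        (if update f i b j = a then x (update (update f i b) j b) else 0) else 0 := by
      intro a b
      refine Finset.sum_congr rfl fun i _ => ?_
      split_ifs <;> simp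
    simp only [this]
    rw [Finset.sum_congr rfl fun a _ => Finset.sum_comm, Finset.sum_comm]
    refine Finset.sum_congr rfl fun i _ => ?_
    rw [Finset.sum_congr rfl fun a _ => Finset.sum_comm, Finset.sum_comm]
  have h2 : ∀ i j, (∑ a, ∑ b,
      if f i = a then (if update f i b j = a then x (update (update f i b) j b) else 0) else 0)
      = (if i = j then x f else 0) +
        (if i = j then 0 else
          if f i = f j then ∑ b, x (update (update f i b) j b) else 0) := by
    intro i j
    rw [Finset.sum_comm]
    simp only [Finset.sum_ite_eq, Finset.mem_univ, if_true]
    by_cases h : i = j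
    · subst h; simp
    · simp only [h, if_false, update_of_ne (Ne.symm h), zero_add]
      split_ifs <;> simp_all [eq_comm]
  rw [h1]
  simp only [h2, Finset.sum_add_distrib]
  simp

/-- adjointness -/
lemma DD_adj (a b : Fin m) (v u : TI m ι) :
    ∑ f, star (v f) * DD a b u f = ∑ f, star (DD b a v f) * u f := by
  simp only [DD, Finset.mul_sum, star_sum, Finset.sum_mul]
  rw [Finset.sum_comm, Finset.sum_comm (s := (Finset.univ : Finset (ι → Fin m)))]
  refine Finset.sum_congr rfl fun i _ => ?_
  simp only [mul_ite, mul_zero, apply_ite star, star_zero, ite_mul, zero_mul, ← Finset.sum_filter]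
  refine Finset.sum_bij' (fun f _ => update f i b) (fun f _ => update f i a) ?_ ?_ ?_ ?_ ?_
  · simp
  · simp
  · intro f hf
    simp at hf; simp [← hf]
  · intro f hf
    simp at hf; simp [← hf]
  · intro f hf
    simp at hf; simp [← hf]

noncomputable def TT (x : TI m ι) : TI m ι := fun f =>
  (Fintype.card ι : ℂ) * m * x f - (Fintype.card ι : ℂ) * x f
        + ∑ i, ∑ j, if i = j then 0 else x (f ∘ Equiv.swap i j)

lemma TT_eq_DD (x : TI m ι) (f : ι → Fin m) :
    TT x f = ∑ a, ∑ b, DD a b (DD b a x) f - (Fintype.card ι : ℂ) * x f := by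
  rw [DD1, TT]; ring

lemma TT_adj (v u : TI m ι) :
    ∑ f, star (v f) * TT u f = ∑ f, star (TT v f) * u f := by
  simp only [TT_eq_DD, mul_sub, star_sub, sub_mul, Finset.sum_sub_distrib, Finset.mul_sum,
    star_sum, Finset.sum_mul]
  congr 1
  · rw [Finset.sum_comm, Finset.sum_comm (s := (Finset.univ : Finset (ι → Fin m)))]
    refine Finset.sum_congr rfl fun a _ => ?_
    rw [Finset.sum_comm, Finset.sum_comm (s := (Finset.univ : Finset (ι → Fin m)))]
    refine Finset.sum_congr rfl fun b _ => ?_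
    rw [DD_adj, DD_adj]
  · refine Finset.sum_congr rfl fun f _ => ?_
    simp; ring

lemma DD_diag (a : Fin m) (u : TI m ι) (f : ι → Fin m) :
    DD a a u f = ((Finset.univ.filter fun i => f i = a).card : ℂ) * u f := by
  simp only [DD]
  rw [← Finset.sum_filter, Finset.sum_congr rfl (g := fun _ => u f)]
  · simp
  · intro i hi
    simp at hi; simp [← hi]

lemma ker_aux (u : TI m ι) (h : ∀ f, TT u f = 0) :
    (∀ a b, a ≠ b → ∀ f, DD a b u f = 0) ∧ ∀ f, u f ≠ 0 → Injective f := by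
  set n : (ι → Fin m) → Fin m → ℝ := fun f a => ((Finset.univ.filter fun i => f i = a).card : ℝ)
    with hn
  have hsum : ∀ f, ∑ a, n f a = Fintype.card ι := by
    intro f
    simp only [hn]
    rw [← Nat.cast_sum, ← Finset.card_eq_sum_card_fiberwise (s := Finset.univ) (t := Finset.univ)]
    · simp
    · intro x _; simp
  have key : ∑ a, ∑ b, ∑ f, ‖DD a b u f‖ ^ 2 = (Fintype.card ι : ℝ) * ∑ f, ‖u f‖ ^ 2 := by
    have h0 : ∑ f, star (u f) * TT u f = 0 := by simp [h]
    simp only [TT_eq_DD, mul_sub, Finset.sum_sub_distrib, Finset.mul_sum] at h0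
    rw [sub_eq_zero, Finset.sum_comm] at h0
    have h1 : ∀ a : Fin m, ∑ f, ∑ b, star (u f) * DD a b (DD b a u) f
        = ∑ b, ∑ f, ((‖DD b a u f‖ ^ 2 : ℝ) : ℂ) := by
      intro a
      rw [Finset.sum_comm]
      refine Finset.sum_congr rfl fun b _ => ?_
      rw [DD_adj]
      refine Finset.sum_congr rfl fun f _ => ?_
      push_cast
      exact Complex.conj_mul' _
    rw [Finset.sum_congr rfl fun a _ => h1 a, Finset.sum_comm] at h0
    have h2 : ∑ f, star (u f) * ((Fintype.card ι : ℂ) * u f)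
        = (((Fintype.card ι : ℝ) * ∑ f, ‖u f‖ ^ 2 : ℝ) : ℂ) := by
      push_cast
      rw [Finset.mul_sum]
      refine Finset.sum_congr rfl fun f _ => ?_
      rw [← Complex.conj_mul']
      simp; ring
    rw [h2] at h0
    exact_mod_cast h0
  have key2 : ∑ a, ∑ b, (if a = b then ∑ f, (n f a ^ 2 - n f a) * ‖u f‖ ^ 2
      else ∑ f, ‖DD a b u f‖ ^ 2) = 0 := by
    have e1 : ∀ a b : Fin m, (if a = b then ∑ f, (n f a ^ 2 - n f a) * ‖u f‖ ^ 2
      else ∑ f, ‖DD a b u f‖ ^ 2) = ∑ f, ‖DD a b u f‖ ^ 2 -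
        (if a = b then ∑ f, n f a * ‖u f‖ ^ 2 else 0) := by
      intro a b
      split_ifs with hab
      · subst hab
        rw [← Finset.sum_sub_distrib]
        refine Finset.sum_congr rfl fun f _ => ?_
        rw [DD_diag, norm_mul, mul_pow, Complex.norm_natCast]
        ring
      · simp
    simp only [e1, Finset.sum_sub_distrib, key]
    simp only [Finset.sum_ite_eq, Finset.mem_univ, if_true]
    rw [Finset.sum_comm]
    simp only [← Finset.sum_mul, hsum]
    rw [Finset.mul_sum, sub_self]
  have npos : ∀ f a, 0 ≤ n f a ^ 2 - n f a := by
    intro f a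
    simp only [hn]
    have : ((Finset.univ.filter fun i => f i = a).card) ≤
      ((Finset.univ.filter fun i => f i = a).card) ^ 2 := Nat.le_self_pow (by norm_num) _
    rw [sub_nonneg]; exact_mod_cast this
  have tpos : ∀ a b : Fin m, 0 ≤ (if a = b then ∑ f, (n f a ^ 2 - n f a) * ‖u f‖ ^ 2
      else ∑ f, ‖DD a b u f‖ ^ 2) := by
    intro a b
    split_ifs
    · exact Finset.sum_nonneg fun f _ => mul_nonneg (npos f a) (sq_nonneg _)
    · exact Finset.sum_nonneg fun f _ => sq_nonneg _
  have key3 : ∀ a b : Fin m, (if a = b then ∑ f, (n f a ^ 2 - n f a) * ‖u f‖ ^ 2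
      else ∑ f, ‖DD a b u f‖ ^ 2) = 0 := by
    intro a b
    have h1 := (Finset.sum_eq_zero_iff_of_nonneg
      (fun a _ => Finset.sum_nonneg fun b _ => tpos a b)).1 key2 a (Finset.mem_univ _)
    exact (Finset.sum_eq_zero_iff_of_nonneg (fun b _ => tpos a b)).1 h1 b (Finset.mem_univ _)
  constructor
  · intro a b hab f
    have h1 := key3 a b
    rw [if_neg hab] at h1
    have := (Finset.sum_eq_zero_iff_of_nonneg (fun f _ => sq_nonneg _)).1 h1 f (Finset.mem_univ _)
    simpa using this
  · intro f hf i j hij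
    have h1 := key3 (f i) (f i)
    rw [if_pos rfl] at h1
    have := (Finset.sum_eq_zero_iff_of_nonneg
      (fun g _ => mul_nonneg (npos g (f i)) (sq_nonneg _))).1 h1 f (Finset.mem_univ _)
    have h2 : n f (f i) ^ 2 - n f (f i) = 0 := by
      rcases mul_eq_zero.1 this with h | h
      · exact h
      · exact absurd (by simpa using h) hf
    have h3 : n f (f i) * (n f (f i) - 1) = 0 := by linarith [h2, sq (n f (f i))]
    simp only [hn] at h3
    have h4 : (Finset.univ.filter fun k => f k = f i).card ≤ 1 := by
      rcases mul_eq_zero.1 h3 with h | h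
      · have : (Finset.univ.filter fun k => f k = f i).card = 0 := by exact_mod_cast h
        omega
      · have : (Finset.univ.filter fun k => f k = f i).card = 1 := by
          exact_mod_cast sub_eq_zero.1 h
        omega
    exact Finset.card_le_one.1 h4 i (by simp) j (by simp [hij])

lemma orth_decomp {α : Type} [Fintype α] (W : Submodule ℂ (α → ℂ)) (x : α → ℂ) :
    ∃ w ∈ W, ∀ v ∈ W, ∑ i, star (v i) * (x i - w i) = 0 := by
  classical
  let L := (WithLp.linearEquiv 2 ℂ (α → ℂ))
  let W' : Submodule ℂ (EuclideanSpace ℂ α) := W.comap L.toLinearMap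
  obtain ⟨y, hy, z, hz, hyz⟩ := W'.exists_add_mem_mem_orthogonal (WithLp.toLp 2 x)
  refine ⟨L y, hy, fun v hv => ?_⟩
  have := (Submodule.mem_orthogonal _ _).1 hz (WithLp.toLp 2 v) hv
  have hz' : ∀ i, z i = x i - L y i := by
    intro i
    have := congrArg (fun w : EuclideanSpace ℂ α => w i) hyz
    simp at this
    rw [this]; simp [L]
  rw [PiLp.inner_apply] at this
  rw [← this]
  refine Finset.sum_congr rfl fun i _ => ?_
  rw [hz']
  simp [mul_comm]

noncomputable def JJ (a b : Fin m) : Matrix (Fin m) (Fin m) ℂ :=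
  Matrix.single a a 1 + Matrix.single b b 1
noncomputable def XX (a b : Fin m) : Matrix (Fin m) (Fin m) ℂ :=
  Matrix.single a b 1 - Matrix.single b a 1
noncomputable def RR (a b : Fin m) (t : ℂ) : Matrix (Fin m) (Fin m) ℂ :=
  1 + (Complex.cos t - 1) • JJ a b + Complex.sin t • XX a b

lemma RR_add {a b : Fin m} (h : a ≠ b) (t s : ℂ) : RR a b t * RR a b s = RR a b (t + s) := by
  have hJJ : JJ a b * JJ a b = JJ a b := by
    simp [JJ, mul_add, add_mul, h, h.symm]
  have hJX : JJ a b * XX a b = XX a b := by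
    simp [JJ, XX, mul_sub, add_mul, h, h.symm]; try abel
  have hXJ : XX a b * JJ a b = XX a b := by
    simp [JJ, XX, sub_mul, mul_add, h, h.symm]; try abel
  have hXX : XX a b * XX a b = - JJ a b := by
    simp [JJ, XX, mul_sub, sub_mul, h, h.symm]; try abel
  simp only [RR, mul_add, add_mul, one_mul, mul_one, Matrix.smul_mul, Matrix.mul_smul,
    hJJ, hJX, hXJ, hXX, Complex.cos_add, Complex.sin_add]
  module

lemma RR_zero (a b : Fin m) : RR a b 0 = 1 := by simp [RR]

lemma RR_tr (a b : Fin m) (t : ℂ) : (RR a b t).transpose = RR a b (-t) := by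
  simp only [RR, JJ, XX, Matrix.transpose_add, Matrix.transpose_smul, Matrix.transpose_sub,
    Matrix.transpose_single, Matrix.transpose_one, Complex.cos_neg, Complex.sin_neg]
  module

lemma RR_orth {a b : Fin m} (h : a ≠ b) (t : ℂ) : IsOrth (RR a b t) := by
  rw [IsOrth, RR_tr, RR_add h]; simp [RR_zero]

lemma RR_det {a b : Fin m} (h : a ≠ b) (t : ℂ) : (RR a b t).det = 1 := by
  have h1 := congrArg Matrix.det (RR_orth h (t / 2))
  rw [Matrix.det_mul, Matrix.det_transpose, Matrix.det_one] at h1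
  rw [← add_halves t, ← RR_add h, Matrix.det_mul, h1]

lemma RR_deriv (a b c d : Fin m) : HasDerivAt (fun t => RR a b t c d) (XX a b c d) 0 := by
  have h1 : HasDerivAt (fun t : ℂ => (1 : Matrix (Fin m) (Fin m) ℂ) c d
      + (Complex.cos t - 1) * JJ a b c d + Complex.sin t * XX a b c d)
      ((-Complex.sin 0) * JJ a b c d + Complex.cos 0 * XX a b c d) 0 :=
    ((((Complex.hasDerivAt_cos 0).sub_const 1).mul_const _).const_add _).add
      ((Complex.hasDerivAt_sin 0).mul_const _)
  simpa [RR] using h1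

lemma sum_one_prod (i : ι) (f : ι → Fin m) (Y : Fin m → ℂ) (x : TI m ι) :
    ∑ f' : ι → Fin m, ((∏ j ∈ Finset.univ.erase i, (1 : Matrix (Fin m) (Fin m) ℂ) (f j) (f' j))
      * Y (f' i)) * x f' = ∑ c, Y c * x (update f i c) := by
  have h : ∀ c, Y c * x (update f i c) =
      ∑ f' : ι → Fin m, if f' = update f i c then Y c * x f' else 0 := by
    intro c; simp
  simp only [h]
  rw [Finset.sum_comm]
  refine Finset.sum_congr rfl fun f' _ => ?_
  by_cases hf : ∀ j, j ≠ i → f' j = f j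
  · rw [Finset.prod_eq_one]
    · have : ∀ c, (f' = update f i c) ↔ f' i = c := by
        intro c
        rw [eq_update_iff]
        exact ⟨fun h => h.1, fun h => ⟨h, hf⟩⟩
      simp [this]
    · intro j hj
      rw [hf j (by simpa using hj)]; simp
  · have : ∀ c, ¬ (f' = update f i c) := by
      intro c hc
      rw [eq_update_iff] at hc
      exact hf hc.2
    simp only [this, if_false, Finset.sum_const_zero]
    push Not at hf
    obtain ⟨j, hj, hne⟩ := hf
    rw [Finset.prod_eq_zero (i := j) (by simpa using hj)]
    · simp
    · simp [Ne.symm hne]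

lemma DD_symm (x : TI m ι)
    (hx : ∀ A : Matrix (Fin m) (Fin m) ℂ, IsOrth A → A.det = 1 → actI A x = x) (a b : Fin m) :
    DD a b x = DD b a x := by
  by_cases hab : a = b
  · rw [hab]
  funext f
  have h1 : HasDerivAt (fun t => actI (RR a b t) x f)
      (∑ f' : ι → Fin m, (∑ i, (∏ j ∈ Finset.univ.erase i, RR a b 0 (f j) (f' j)) •
        XX a b (f i) (f' i)) * x f') 0 := by
    unfold actI
    refine HasDerivAt.fun_sum fun f' _ => HasDerivAt.mul_const ?_ _
    exact HasDerivAt.fun_finsetProd fun i _ => RR_deriv a b (f i) (f' i)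
  have h2 : (fun t => actI (RR a b t) x f) = fun _ => x f := by
    funext t; rw [hx _ (RR_orth hab t) (RR_det hab t)]
  rw [h2] at h1
  have h3 := h1.unique (hasDerivAt_const _ _)
  simp only [RR_zero, smul_eq_mul, Finset.sum_mul] at h3
  rw [Finset.sum_comm] at h3
  have h4 : ∀ i, ∑ c, XX a b (f i) c * x (update f i c) =
      (if f i = a then x (update f i b) else 0) - (if f i = b then x (update f i a) else 0) := by
    intro i
    simp only [XX, Matrix.sub_apply, Matrix.single_apply, sub_mul, Finset.sum_sub_distrib, ite_and,
      ite_mul, one_mul, zero_mul]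
    congr 1
    · by_cases h : f i = a
      · simp [h]
      · simp [h, Ne.symm h]
    · by_cases h : f i = b
      · simp [h]
      · simp [h, Ne.symm h]
  rw [Finset.sum_congr rfl fun i _ => (sum_one_prod i f (XX a b (f i)) x).trans (h4 i),
    Finset.sum_sub_distrib, sub_eq_zero] at h3
  exact h3

lemma TT_inv (x : TI m ι)
    (hx : ∀ A : Matrix (Fin m) (Fin m) ℂ, IsOrth A → A.det = 1 → actI A x = x) (f : ι → Fin m) :
    TT x f = ∑ i, ∑ j, if i = j then 0 else
          if f i = f j then ∑ b, x (update (update f i b) j b) else 0 := by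
  have h : ∑ a, ∑ b, DD a b (DD b a x) f = ∑ a, ∑ b, DD a b (DD a b x) f := by
    refine Finset.sum_congr rfl fun a _ => Finset.sum_congr rfl fun b _ => ?_
    rw [DD_symm x hx a b]
  rw [TT_eq_DD, h, DD2]; ring

/-- spaces -/
noncomputable def OI (m : ℕ) (ι : Type) [Fintype ι] [DecidableEq ι] : Submodule ℂ (TI m ι) where
  carrier := {x | ∀ A, IsOrth A → actI A x = x}
  add_mem' := by
    intro x y hx hy A hA
    conv_rhs => rw [← hx A hA, ← hy A hA]
    funext f
    simp [actI, mul_add, Finset.sum_add_distrib]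
  zero_mem' := by intro A hA; funext f; simp [actI]
  smul_mem' := by
    intro c x hx A hA
    conv_rhs => rw [← hx A hA]
    funext f
    simp only [actI, Pi.smul_apply, smul_eq_mul, Finset.mul_sum]
    exact Finset.sum_congr rfl fun f' _ => by ring

noncomputable def SI (m : ℕ) (ι : Type) : Submodule ℂ (TI m ι) :=
  Submodule.span ℂ {y | ∃ d : ℕ, ∃ e : Fin (m + 2 * d) ≃ ι,
    y = fun f => tmul (Lam m) (cCpow m d) (f ∘ e)}

noncomputable def WI (m : ℕ) (ι : Type) [Fintype ι] [DecidableEq ι] : Submodule ℂ (TI m ι) :=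
  OI m ι ⊔ SI m ι

def reidx (e : κ ≃ ι) : TI m κ →ₗ[ℂ] TI m ι where
  toFun x := fun f => x (f ∘ e)
  map_add' _ _ := rfl
  map_smul' _ _ := rfl

lemma actI_reidx (A : Matrix (Fin m) (Fin m) ℂ) (e : κ ≃ ι) (x : TI m κ) :
    actI A (reidx e x) = reidx e (actI A x) := by
  funext f
  simp only [actI, reidx, LinearMap.coe_mk, AddHom.coe_mk]
  refine Fintype.sum_equiv (Equiv.arrowCongr e.symm (Equiv.refl _)) _ _ fun f' => ?_
  congr 1
  exact (Equiv.prod_comp e (fun i => A (f i) (f' i))).symm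

lemma reidx_W (e : κ ≃ ι) {x : TI m κ} (hx : x ∈ WI m κ) : reidx e x ∈ WI m ι := by
  have : WI m κ ≤ (WI m ι).comap (reidx e) := by
    refine sup_le ?_ ?_
    · intro y hy
      refine Submodule.mem_sup_left ?_
      intro A hA
      rw [actI_reidx, hy A hA]
    · refine Submodule.span_le.2 ?_
      rintro _ ⟨d, e', rfl⟩
      exact Submodule.mem_sup_right (Submodule.subset_span ⟨d, e'.trans e, rfl⟩)
  exact this hx

noncomputable def ins : TI m κ →ₗ[ℂ] TI m (κ ⊕ Fin 2) where
  toFun y := fun f => y (f ∘ Sum.inl) * (if f (Sum.inr 0) = f (Sum.inr 1) then 1 else 0)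
  map_add' _ _ := by funext f; simp only [Pi.add_apply, add_mul]
  map_smul' _ _ := by funext f; simp only [Pi.smul_apply, smul_eq_mul, RingHom.id_apply, mul_assoc]

noncomputable def contr (x : TI m (κ ⊕ Fin 2)) : TI m κ :=
  fun g => ∑ b, x (Sum.elim g (fun _ => b))

lemma sum_split (F : (κ ⊕ Fin 2 → Fin m) → ℂ) :
    ∑ f, F f = ∑ g : κ → Fin m, ∑ c, ∑ d, F (Sum.elim g ![c, d]) := by
  rw [← Equiv.sum_comp (Equiv.sumArrowEquivProdArrow κ (Fin 2) (Fin m)).symm, Fintype.sum_prod_type]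
  refine Finset.sum_congr rfl fun g _ => ?_
  rw [← Equiv.sum_comp (finTwoArrowEquiv (Fin m)).symm, Fintype.sum_prod_type]
  rfl

lemma actI_ins (A : Matrix (Fin m) (Fin m) ℂ) (hA : IsOrth A) (y : TI m κ) :
    actI A (ins y) = ins (actI A y) := by
  have hA' : A * A.transpose = 1 := mul_eq_one_comm.1 hA
  funext f
  simp only [actI, ins, LinearMap.coe_mk, AddHom.coe_mk]
  rw [sum_split, Finset.sum_mul]
  refine Finset.sum_congr rfl fun g _ => ?_
  have := congrFun (congrFun hA' (f (Sum.inr 0))) (f (Sum.inr 1))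
  rw [Matrix.mul_apply, Matrix.one_apply] at this
  rw [← this, Finset.mul_sum]
  refine Finset.sum_congr rfl fun c _ => ?_
  simp [Fintype.prod_sum_type, Matrix.transpose_apply]
  ring_nf

lemma actI_contr (A : Matrix (Fin m) (Fin m) ℂ) (hA : IsOrth A) (x : TI m (κ ⊕ Fin 2)) :
    actI A (contr x) = contr (actI A x) := by
  funext g
  simp only [actI, contr]
  simp only [sum_split (κ := κ)]
  rw [Finset.sum_comm]
  refine Finset.sum_congr rfl fun g' _ => ?_
  rw [Finset.sum_comm, Finset.mul_sum]
  refine Finset.sum_congr rfl fun c _ => ?_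
  rw [Finset.sum_comm]
  have h1 : ∀ d, ∑ b, A b c * A b d = if c = d then 1 else 0 := by
    intro d
    have := congrFun (congrFun hA c) d
    rw [Matrix.mul_apply, Matrix.one_apply] at this
    exact this
  have h2 : ∀ d : Fin m, (∑ b, (∏ i, A (Sum.elim g (fun _ => b) i) (Sum.elim g' ![c, d] i)) *
      x (Sum.elim g' ![c, d])) = (if c = d then 1 else 0) * ((∏ i, A (g i) (g' i)) *
      x (Sum.elim g' ![c, d])) := by
    intro d
    rw [← h1, Finset.sum_mul]
    refine Finset.sum_congr rfl fun b _ => ?_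
    simp [Fintype.prod_sum_type]
    ring
  simp only [h2]
  simp
  left
  congr 2
  funext i
  fin_cases i <;> rfl

lemma gen_ins (d : ℕ) (f : Fin (m + 2 * (d + 1)) → Fin m) :
    tmul (Lam m) (cCpow m (d + 1)) f =
      tmul (Lam m) (cCpow m d) (fun i => f (Fin.castAdd 2 i)) *
       (if f (Fin.natAdd (m + 2 * d) (0 : Fin 2)) = f (Fin.natAdd (m + 2 * d) (1 : Fin 2))
        then 1 else 0) := by
  simp only [tmul, cCpow, Fin.prod_univ_castSucc, mul_assoc]
  rfl

lemma ins_W {y : TI m κ} (hy : y ∈ WI m κ) : ins y ∈ WI m (κ ⊕ Fin 2) := by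
  have : WI m κ ≤ (WI m (κ ⊕ Fin 2)).comap ins := by
    refine sup_le ?_ ?_
    · intro y hy
      refine Submodule.mem_sup_left ?_
      intro A hA
      rw [actI_ins A hA, hy A hA]
    · refine Submodule.span_le.2 ?_
      rintro _ ⟨d, e', rfl⟩
      refine Submodule.mem_sup_right (Submodule.subset_span ⟨d + 1,
        (finSumFinEquiv (m := m + 2 * d) (n := 2)).symm.trans
          (Equiv.sumCongr e' (Equiv.refl _)), ?_⟩)
      funext f
      rw [gen_ins]
      simp only [ins, LinearMap.coe_mk, AddHom.coe_mk, comp_apply, Equiv.trans_apply,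
        finSumFinEquiv_symm_apply_castAdd, finSumFinEquiv_symm_apply_natAdd]
      rfl
  exact this hy

lemma exists_e (n : ℕ) {i j : Fin (n + 2)} (h : i ≠ j) :
    ∃ e : Fin n ⊕ Fin 2 ≃ Fin (n + 2), e (Sum.inr 0) = i ∧ e (Sum.inr 1) = j := by
  let e0 : Fin n ⊕ Fin 2 ≃ Fin (n + 2) := finSumFinEquiv
  let e1 := e0.trans (Equiv.swap (e0 (Sum.inr 0)) i)
  have h1 : e1 (Sum.inr 0) = i := by simp [e1]
  have h2 : i ≠ e1 (Sum.inr 1) := by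
    rw [← h1]; intro h; simpa using e1.injective h
  refine ⟨e1.trans (Equiv.swap (e1 (Sum.inr 1)) j), ?_, ?_⟩
  · rw [Equiv.trans_apply, h1, Equiv.swap_apply_of_ne_of_ne h2 h]
  · simp

lemma K_eq (e : κ ⊕ Fin 2 ≃ ι) (x : TI m ι) :
    (fun f : ι → Fin m => if f (e (Sum.inr 0)) = f (e (Sum.inr 1)) then
      ∑ b, x (update (update f (e (Sum.inr 0)) b) (e (Sum.inr 1)) b) else 0)
    = reidx e (ins (contr (reidx e.symm x))) := by
  funext f
  simp only [reidx, ins, contr, LinearMap.coe_mk, AddHom.coe_mk, comp_apply]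
  split_ifs with h
  · rw [mul_one]
    refine Finset.sum_congr rfl fun b _ => ?_
    congr 1
    funext k
    obtain ⟨s, rfl⟩ := e.surjective k
    rcases s with s | s
    · simp [update_apply]
    · fin_cases s <;> simp [update_apply]
  · simp

lemma ker_SI (hι : Nonempty ι) (u : TI m ι) (h : ∀ f, TT u f = 0) : u ∈ SI m ι := by
  obtain ⟨hD, hinj⟩ := ker_aux u h
  by_cases hu : u = 0
  · rw [hu]; exact Submodule.zero_mem _
  obtain ⟨f0, hf0⟩ : ∃ f, u f ≠ 0 := by
    by_contra! hc
    exact hu (funext hc)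
  have i0 := hinj f0 hf0
  have s0 : Surjective f0 := by
    by_contra hs
    simp only [Surjective, not_forall, not_exists] at hs
    obtain ⟨b, hb⟩ := hs
    obtain ⟨i⟩ := hι
    have h1 := hD b (f0 i) (Ne.symm (hb i)) (update f0 i b)
    simp only [DD] at h1
    rw [Finset.sum_eq_single i] at h1
    · simp at h1; exact hf0 h1
    · intro j _ hj
      rw [update_of_ne hj, if_neg (hb j)]
    · simp
  let e : Fin m ≃ ι := (Equiv.ofBijective f0 ⟨i0, s0⟩).symm
  have he : ∀ a, f0 (e a) = a := fun a => (Equiv.ofBijective f0 ⟨i0, s0⟩).apply_symm_apply a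
  have he' : ∀ i, e (f0 i) = i := fun a => (Equiv.ofBijective f0 ⟨i0, s0⟩).symm_apply_apply a
  have hswap : ∀ f : ι → Fin m, Bijective f → ∀ a b, a ≠ b →
      u (Equiv.swap a b ∘ f) = - u f := by
    intro f hf a b hab
    obtain ⟨i, rfl⟩ := hf.2 a
    obtain ⟨j, rfl⟩ := hf.2 b
    have hij : i ≠ j := fun h => hab (by rw [h])
    have h1 := hD (f j) (f i) (Ne.symm hab) (update f i (f j))
    simp only [DD] at h1
    rw [Finset.sum_eq_add i j hij] at h1
    · have h2 : Equiv.swap (f i) (f j) ∘ f = f ∘ Equiv.swap i j := by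
        funext k
        simp only [comp_apply, Equiv.swap_apply_def, hf.1.eq_iff]
        split_ifs <;> rfl
      rw [if_pos (by simp), if_pos (by simp [update_of_ne (Ne.symm hij)]), upd_swap f hij] at h1
      simp at h1
      rw [h2]
      exact (neg_eq_of_add_eq_zero_right h1).symm
    · intro k _ hk
      rw [update_of_ne hk.1, if_neg]
      exact fun h => hk.2 (hf.1 h)
    · simp
    · simp
  have hsign : ∀ τ : Equiv.Perm (Fin m), u (τ ∘ f0) = ((Equiv.Perm.sign τ : ℤ) : ℂ) * u f0 := by
    intro τ
    induction τ using Equiv.Perm.swap_induction_on with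
    | one => simp
    | swap_mul τ a b hab ih =>
      have := hswap (τ ∘ f0) (τ.bijective.comp ⟨i0, s0⟩) a b hab
      rw [Equiv.Perm.coe_mul, comp_assoc, this, ih, Equiv.Perm.sign_mul, Equiv.Perm.sign_swap hab]
      simp
  have hfin : u = ((m.factorial : ℂ) * u f0) •
      (fun f => tmul (Lam m) (cCpow m 0) (f ∘ e) : TI m ι) := by
    funext g
    have h1 : tmul (Lam m) (cCpow m 0) (g ∘ e) = Lam m (g ∘ e) := by
      simp only [tmul, cCpow, Finset.univ_eq_empty, Finset.prod_empty, mul_one]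
      rfl
    have hm : (m.factorial : ℂ) ≠ 0 := by exact_mod_cast m.factorial_ne_zero
    rw [Pi.smul_apply, h1, Lam, smul_eq_mul]
    by_cases hg : Injective g
    · have hb : Bijective (g ∘ e) := Finite.injective_iff_bijective.1 (hg.comp e.injective)
      let τ : Equiv.Perm (Fin m) := Equiv.ofBijective _ hb
      have hτ : ∀ i, (g ∘ e) i = τ i := fun i => rfl
      have hg' : g = τ ∘ f0 := by
        funext i
        rw [comp_apply, ← hτ, comp_apply, he']
      rw [Finset.sum_eq_single τ]
      · rw [if_pos hτ]
        conv_lhs => rw [hg', hsign]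
        field_simp
      · intro σ _ hσ
        rw [if_neg, mul_zero]
        intro hc
        exact hσ (Equiv.ext fun i => (hc i).symm)
      · simp
    · have : u g = 0 := by
        by_contra hc
        exact hg (hinj g hc)
      rw [this, Finset.sum_eq_zero]
      · simp
      · intro σ _
        rw [if_neg, mul_zero]
        intro hc
        apply hg
        intro i j hij
        have h2 : σ (f0 i) = σ (f0 j) := by
          rw [← hc, ← hc, comp_apply, comp_apply, he', he', hij]
        exact i0 (σ.injective h2)
  rw [hfin]
  exact Submodule.smul_mem _ _ (Submodule.subset_span ⟨0, e, rfl⟩)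

lemma TT_W {x : TI m ι} (hx : x ∈ WI m ι) : TT x ∈ WI m ι := by
  have : TT x = ((Fintype.card ι : ℂ) * m - (Fintype.card ι : ℂ)) • x
      + ∑ i, ∑ j, if i = j then 0 else reidx (Equiv.swap i j) x := by
    funext f
    simp only [TT, Pi.add_apply, Pi.smul_apply, smul_eq_mul, Finset.sum_apply]
    congr 1
    · ring
    · refine Finset.sum_congr rfl fun i _ => Finset.sum_congr rfl fun j _ => ?_
      split_ifs <;> rfl
  rw [this]
  refine Submodule.add_mem _ (Submodule.smul_mem _ _ hx) ?_
  refine Submodule.sum_mem _ fun i _ => Submodule.sum_mem _ fun j _ => ?_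
  split_ifs
  · exact Submodule.zero_mem _
  · exact reidx_W _ hx

lemma mem_of_TT (hι : Nonempty ι) (x : TI m ι) (hx : TT x ∈ WI m ι) : x ∈ WI m ι := by
  obtain ⟨w, hw, ho⟩ := orth_decomp (WI m ι) x
  have hadd : ∀ f, TT (x - w) f = TT x f - TT w f := by
    intro f
    have : ∀ i j : ι, (if i = j then 0 else (x - w) (f ∘ Equiv.swap i j)) =
      (if i = j then 0 else x (f ∘ Equiv.swap i j)) -
      (if i = j then 0 else w (f ∘ Equiv.swap i j)) := by
      intro i j; split_ifs <;> simp
    simp only [TT, this]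
    simp only [Finset.sum_sub_distrib, Pi.sub_apply]
    ring
  have hT : TT (x - w) ∈ WI m ι := by
    have : TT (x - w) = TT x - TT w := funext hadd
    rw [this]
    exact Submodule.sub_mem _ hx (TT_W hw)
  have h0 : ∑ f, star (TT (x - w) f) * TT (x - w) f = 0 := by
    rw [TT_adj]
    exact ho _ (TT_W hT)
  have hz : ∀ f, TT (x - w) f = 0 := by
    have h1 : ∑ f, ‖TT (x - w) f‖ ^ 2 = 0 := by
      have : ((∑ f, ‖TT (x - w) f‖ ^ 2 : ℝ) : ℂ) = 0 := by
        rw [← h0]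
        push_cast
        exact Finset.sum_congr rfl fun f _ => (Complex.conj_mul' _).symm
      exact_mod_cast this
    intro f
    have := (Finset.sum_eq_zero_iff_of_nonneg (fun f _ => sq_nonneg _)).1 h1 f (Finset.mem_univ _)
    simpa using this
  have := Submodule.add_mem _ (Submodule.mem_sup_right (S := OI m ι) (ker_SI hι _ hz)) hw
  rw [sub_add_cancel] at this
  exact this

lemma main_W (n : ℕ) : ∀ x : TI m (Fin n),
    (∀ A : Matrix (Fin m) (Fin m) ℂ, IsOrth A → A.det = 1 → actI A x = x) → x ∈ WI m (Fin n) := by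
  induction n using Nat.strong_induction_on with
  | _ n ih =>
  intro x hx
  by_cases hn : n = 0
  · subst hn
    refine Submodule.mem_sup_left ?_
    intro A _
    funext f
    simp only [actI, Finset.univ_eq_empty, Finset.prod_empty, one_mul, Finset.univ_unique,
      Finset.sum_singleton]
    exact congrArg x (Subsingleton.elim _ _)
  refine mem_of_TT ⟨⟨0, Nat.pos_of_ne_zero hn⟩⟩ x ?_
  have : TT x = ∑ i, ∑ j, if i = j then 0 else fun f : Fin n → Fin m =>
          if f i = f j then ∑ b, x (update (update f i b) j b) else 0 := by
    funext f
    rw [TT_inv x hx]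
    simp only [Finset.sum_apply]
    refine Finset.sum_congr rfl fun i _ => Finset.sum_congr rfl fun j _ => ?_
    by_cases h : i = j
    · simp [h]
    · simp only [h, if_false]
  rw [this]
  refine Submodule.sum_mem _ fun i _ => Submodule.sum_mem _ fun j _ => ?_
  split_ifs with hij
  · exact Submodule.zero_mem _
  · obtain ⟨k, rfl⟩ : ∃ k, n = k + 2 := by
      refine ⟨n - 2, ?_⟩
      have := i.isLt
      have := j.isLt
      have : (i : ℕ) ≠ j := fun h => hij (Fin.ext h)
      omega
    obtain ⟨e, rfl, rfl⟩ := exists_e k hij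
    rw [K_eq e x]
    refine reidx_W e (ins_W (ih k (by omega) _ ?_))
    intro A hA hdet
    rw [actI_contr A hA, actI_reidx, hx A hA hdet]

end helpers

/-- FFT for `SO(V)`: every `SO(V)`-invariant of `V^{⊗r}` is `ξ₀ + ξ₁` with `ξ₀` an
`O(V)`-invariant and `ξ₁` in the span of the `S_r`-orbit of `Λ ⊗ Č^{⊗(r-m)/2}` when
`r ≥ m` and `r ≡ m (mod 2)`; otherwise every `SO(V)`-invariant is `O(V)`-invariant
(i.e. `ξ₁ = 0`). -/
theorem stmt_18 (m : ℕ) :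
    (∀ d : ℕ, ∀ x : Tens m (m + 2 * d),
      (∀ A : Matrix (Fin m) (Fin m) ℂ, IsOrth A → A.det = 1 → act A x = x) →
      ∃ x0 x1 : Tens m (m + 2 * d),
        x = x0 + x1 ∧
        (∀ A : Matrix (Fin m) (Fin m) ℂ, IsOrth A → act A x0 = x0) ∧
        x1 ∈ Submodule.span ℂ
          (Set.range fun σ : Equiv.Perm (Fin (m + 2 * d)) =>
            permAct σ (tmul (Lam m) (cCpow m d)))) ∧
    ∀ r : ℕ, ¬(m ≤ r ∧ Even (r - m)) →
      ∀ x : Tens m r,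
        (∀ A : Matrix (Fin m) (Fin m) ℂ, IsOrth A → A.det = 1 → act A x = x) →
        ∀ A : Matrix (Fin m) (Fin m) ℂ, IsOrth A → act A x = x := by
  constructor
  · intro d x hx
    obtain ⟨x0, h0, x1, h1, rfl⟩ := Submodule.mem_sup.1 (main_W (m + 2 * d) x hx)
    refine ⟨x0, x1, rfl, h0, ?_⟩
    refine (Submodule.span_le.2 ?_ : SI m (Fin (m + 2 * d)) ≤ _) h1
    rintro _ ⟨d', e, rfl⟩
    have hc := Fintype.card_congr e
    simp only [Fintype.card_fin] at hc
    obtain rfl : d' = d := by omega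
    exact Submodule.subset_span ⟨e, rfl⟩
  · intro r hr x hx
    obtain ⟨x0, h0, x1, h1, rfl⟩ := Submodule.mem_sup.1 (main_W r x hx)
    have hS : SI m (Fin r) ≤ ⊥ := by
      refine Submodule.span_le.2 ?_
      rintro _ ⟨d, e, rfl⟩
      have hc := Fintype.card_congr e
      simp only [Fintype.card_fin] at hc
      exact absurd ⟨by omega, ⟨d, by omega⟩⟩ hr
    obtain rfl : x1 = 0 := by simpa using hS h1
    rw [add_zero]
    exact h0

end EnhBrauer
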